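/- Let i be a nonnegative integer and let α, β be complex numbers. Assume that (β)_{m+n}, (α/2)_n and (1+(α+β)/2)_n are nonzero for all nonnegative integers m, n, that no argument of Γ appearing on the right-hand side below is a nonpositive integer, and that the double series defining the Kampé de Fériet function converges absolutely. Then F^{1:1;3}_{1:0;2}[α : β/2−3α/2−1+i ; β/2+3α/2+1−i, 1+α/2, (α−β)/2 ; β : — ; α/2, 1+(α+β)/2 ; 1/2, 1/2] = (2^{i−α−2} · Γ(α−i+1) · Γ(1+(α+β)/2)) / (Γ(α+1) · Γ((β−α)/2)) · Σ_{r=0}^{i} (−1)^r · C(i,r) · Γ((β−α)/4+r/2) / Γ((β+3α)/4+1−i+r/2). -/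

import Mathlib

open Complex

noncomputable section

/-- Pochhammer symbol `(a)_n = a (a+1) ⋯ (a+n-1)`. -/
def poch (a : ℂ) (n : ℕ) : ℂ := ∏ k ∈ Finset.range n, (a + k)

/-- `z` is not a nonpositive integer. -/
def notNonposInt (z : ℂ) : Prop := ∀ n : ℕ, z ≠ -(n : ℂ)

/-- Term of the Kampé de Fériet double series `F^{1:1;3}_{1:0;2}`. -/
def kdfTerm (α ε b₁ b₂ b₃ β d₁ d₂ x y : ℂ) (p : ℕ × ℕ) : ℂ :=
  poch α (p.1 + p.2) * poch ε p.1 * poch b₁ p.2 * poch b₂ p.2 * poch b₃ p.2 /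
    (poch β (p.1 + p.2) * poch d₁ p.2 * poch d₂ p.2) * x ^ p.1 * y ^ p.2 /
    ((p.1.factorial : ℂ) * (p.2.factorial : ℂ))

theorem poch_zero (a : ℂ) : poch a 0 = 1 := by simp [poch]

theorem poch_succ (a : ℂ) (n : ℕ) : poch a (n + 1) = poch a n * (a + n) := by
  simp [poch, Finset.prod_range_succ]

theorem poch_succ_left (a : ℂ) (n : ℕ) : poch a (n + 1) = a * poch (a + 1) n := by
  simp only [poch, Finset.prod_range_succ', Nat.cast_zero, add_zero, Nat.cast_add, Nat.cast_one]
  rw [mul_comm]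
  congr 1
  exact Finset.prod_congr rfl fun k _ => by ring

/-- The polynomial form of the Pfaff–Saalschütz summation. -/
theorem sum_saalschutz (A B C : ℂ) (N : ℕ) :
    ∑ ij ∈ Finset.HasAntidiagonal.antidiagonal N, (N.choose ij.1 : ℂ) *
      (poch (C - A - B) ij.2 * poch A ij.1 * poch B ij.1 * poch (C + ij.1) ij.2) =
    poch (C - A) N * poch (C - B) N := by
  induction N with
  | zero => simp [poch_zero]
  | succ N ih =>
    set g : ℕ → ℂ := fun n => n * N.choose n * poch (C - A - B) (N + 1 - n) * poch A n *
      poch B n * poch (C + n) (N - n) with hg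
    have key : ∀ ij ∈ Finset.HasAntidiagonal.antidiagonal N,
        (N.choose ij.1 : ℂ) * (poch (C - A - B) (ij.2 + 1) * poch A ij.1 * poch B ij.1 *
            poch (C + ij.1) (ij.2 + 1)) +
          (N.choose ij.2 : ℂ) * (poch (C - A - B) ij.2 * poch A (ij.1 + 1) * poch B (ij.1 + 1) *
            poch (C + (ij.1 + 1 : ℕ)) ij.2) =
        (C - A + N) * (C - B + N) * ((N.choose ij.1 : ℂ) *
          (poch (C - A - B) ij.2 * poch A ij.1 * poch B ij.1 * poch (C + ij.1) ij.2)) +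
          (g (ij.1 + 1) - g ij.1) := by
      rintro ⟨n, k⟩ h
      obtain rfl : n + k = N := by simpa using h
      have e1 : n + k + 1 - n = k + 1 := by omega
      have e2 : n + k + 1 - (n + 1) = k := by omega
      have e3 : n + k - n = k := by omega
      have e4 : n + k - (n + 1) = k - 1 := by omega
      simp only [hg, e1, e2, e3, e4, ← Nat.choose_symm_add (a := n) (b := k)]
      cases k with
      | zero =>
        simp only [poch_succ, poch_zero, Nat.add_zero, Nat.choose_succ_self, Nat.choose_self]
        push_cast
        ring
      | succ k =>
        have hc : ((n + (k + 1)).choose (n + 1) : ℂ) * (n + 1) =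
            (n + (k + 1)).choose n * (k + 1) := by
          have := Nat.choose_succ_right_eq (n + (k + 1)) n
          rw [show n + (k + 1) - n = k + 1 by omega] at this
          exact_mod_cast this
        have e5 : C + ((n + 1 : ℕ) : ℂ) = C + n + 1 := by push_cast; ring
        rw [Nat.add_sub_cancel, e5, poch_succ_left (C + n), poch_succ_left (C + n)]
        simp only [poch_succ]
        push_cast
        linear_combination (-(poch (C - A - B) k * (C - A - B + k) * poch A n * (A + n) * poch B n *
          (B + n) * poch (C + n + 1) k)) * hc
    have htel : ∑ ij ∈ Finset.HasAntidiagonal.antidiagonal N, (g (ij.1 + 1) - g ij.1) = 0 := by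
      rw [Finset.Nat.sum_antidiagonal_eq_sum_range_succ_mk]
      simp only [Nat.succ_eq_add_one]
      rw [Finset.sum_range_sub]
      simp [hg]
    rw [Finset.sum_antidiagonal_choose_succ_mul (fun i j =>
      poch (C - A - B) j * poch A i * poch B i * poch (C + i) j), ← Finset.sum_add_distrib,
      Finset.sum_congr rfl key, Finset.sum_add_distrib, htel, ← Finset.mul_sum, ih,
      poch_succ, poch_succ]
    ring

/-- The `n`-th term of the regularised Gauss series `₂F₁(a, b; c; 1/2) / Γ(c)`. -/
def halfTerm (a b c : ℂ) (n : ℕ) : ℂ :=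
  poch a n * poch b n / n.factorial * (Gamma (c + n))⁻¹ * (1 / 2) ^ n

theorem halfTerm_zero (a b c : ℂ) : halfTerm a b c 0 = (Gamma c)⁻¹ := by
  simp [halfTerm, poch_zero]

theorem inv_Gamma_add_nat (c : ℂ) (n : ℕ) :
    (Gamma (c + n))⁻¹ = (c + n) * (Gamma (c + n + 1))⁻¹ :=
  Complex.one_div_Gamma_eq_self_mul_one_div_Gamma_add_one _

theorem summable_norm_halfTerm (a b c : ℂ) : Summable fun n => ‖halfTerm a b c n‖ := by
  refine summable_of_ratio_norm_eventually_le (r := 3 / 4) (by norm_num) ?_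
  have hinv : Filter.Tendsto (fun n : ℕ => ((n : ℂ))⁻¹) Filter.atTop (nhds 0) :=
    tendsto_inv_atTop_nhds_zero_nat
  have hlim : Filter.Tendsto (fun n : ℕ => ‖(a * (n : ℂ)⁻¹ + 1) * (b * (n : ℂ)⁻¹ + 1) /
      (2 * ((n : ℂ)⁻¹ + 1) * (c * (n : ℂ)⁻¹ + 1))‖) Filter.atTop
      (nhds ‖(a * 0 + 1) * (b * 0 + 1) / (2 * ((0 : ℂ) + 1) * (c * 0 + 1))‖) := by
    refine Filter.Tendsto.norm (Filter.Tendsto.div ?_ ?_ (by norm_num))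
    · exact ((hinv.const_mul a).add_const 1).mul ((hinv.const_mul b).add_const 1)
    · exact ((hinv.add_const 1).const_mul 2).mul ((hinv.const_mul c).add_const 1)
  have hev := hlim.eventually_le_const (u := 3 / 4) (by norm_num)
  have hc : ∀ᶠ n : ℕ in Filter.atTop, ‖c‖ < n := by
    obtain ⟨m, hm⟩ := exists_nat_gt ‖c‖
    filter_upwards [Filter.eventually_ge_atTop m] with n hn
    exact hm.trans_le (by exact_mod_cast hn)
  filter_upwards [hev, hc] with n hn hcn
  rw [norm_norm, norm_norm]
  have hn0 : (n : ℂ) ≠ 0 := by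
    have : (0 : ℝ) < n := (norm_nonneg c).trans_lt hcn
    exact_mod_cast this.ne'
  have hcn0 : c + n ≠ 0 := by
    intro h
    rw [eq_neg_of_add_eq_zero_left h] at hcn
    simp at hcn
  have hn1 : (n : ℂ) + 1 ≠ 0 := by exact_mod_cast n.succ_ne_zero
  have hf : ((n.factorial : ℕ) : ℂ) ≠ 0 := by exact_mod_cast n.factorial_ne_zero
  have hfac : (a * (n : ℂ)⁻¹ + 1) * (b * (n : ℂ)⁻¹ + 1) /
      (2 * ((n : ℂ)⁻¹ + 1) * (c * (n : ℂ)⁻¹ + 1)) =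
      (a + n) * (b + n) / (2 * (n + 1) * (c + n)) := by
    have h1 : (n : ℂ)⁻¹ + 1 ≠ 0 := by
      rw [show (n : ℂ)⁻¹ + 1 = (n + 1) / n by field_simp; ring]
      exact div_ne_zero hn1 hn0
    have h2 : c * (n : ℂ)⁻¹ + 1 ≠ 0 := by
      rw [show c * (n : ℂ)⁻¹ + 1 = (c + n) / n by field_simp]
      exact div_ne_zero hcn0 hn0
    rw [div_eq_div_iff (mul_ne_zero (mul_ne_zero two_ne_zero h1) h2)
      (mul_ne_zero (mul_ne_zero two_ne_zero hn1) hcn0)]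
    field_simp
    ring
  have hstep : halfTerm a b c (n + 1) =
      (a + n) * (b + n) / (2 * (n + 1) * (c + n)) * halfTerm a b c n := by
    unfold halfTerm
    rw [inv_Gamma_add_nat c n, poch_succ, poch_succ, Nat.factorial_succ, pow_succ]
    push_cast
    rw [← add_assoc]
    field_simp
  rw [hstep, norm_mul, ← hfac]
  exact mul_le_mul_of_nonneg_right hn (norm_nonneg _)

theorem summable_halfTerm (a b c : ℂ) : Summable (halfTerm a b c) :=
  (summable_norm_halfTerm a b c).of_norm

theorem halfTerm_contiguous (a b c : ℂ) (n : ℕ) :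
    a * halfTerm (a + 1) b c n = halfTerm a b (c - 1) n - (c - a - 1) * halfTerm a b c n := by
  have h := inv_Gamma_add_nat (c - 1) n
  rw [show c - 1 + n + 1 = c + n by ring] at h
  have hp : a * poch (a + 1) n = poch a n * (a + n) := by rw [← poch_succ_left, poch_succ]
  unfold halfTerm
  rw [h]
  linear_combination (poch b n / n.factorial * (Gamma (c + n))⁻¹ * (1 / 2) ^ n) * hp

theorem tsum_halfTerm_contiguous (a b c : ℂ) :
    a * ∑' n, halfTerm (a + 1) b c n =
      ∑' n, halfTerm a b (c - 1) n - (c - a - 1) * ∑' n, halfTerm a b c n := by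
  rw [← tsum_mul_left, ← tsum_mul_left,
    ← (summable_halfTerm a b (c - 1)).tsum_sub ((summable_halfTerm a b c).mul_left _)]
  exact tsum_congr (halfTerm_contiguous a b c)

theorem halfTerm_succ (a b c : ℂ) (n : ℕ) :
    ((n + 1 : ℕ) : ℂ) * halfTerm a b c (n + 1) =
      a * b / 2 * halfTerm (a + 1) (b + 1) (c + 1) n := by
  have hn1 : (n : ℂ) + 1 ≠ 0 := by exact_mod_cast n.succ_ne_zero
  have hf : ((n.factorial : ℕ) : ℂ) ≠ 0 := by exact_mod_cast n.factorial_ne_zero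
  unfold halfTerm
  rw [poch_succ_left, poch_succ_left, Nat.factorial_succ, pow_succ]
  push_cast
  rw [show c + (n + 1 : ℂ) = c + 1 + n by ring]
  field_simp

theorem tsum_halfTerm_add_two (a c : ℂ) :
    ∑' n, halfTerm a (1 - a) c n = (c + 1 - a) * (c + a) * ∑' n, halfTerm a (1 - a) (c + 2) n := by
  set V : ℕ → ℂ := fun n => -2 * (n * halfTerm a (1 - a) (c + 1) n) with hV
  have hV1 : Summable fun n => V (n + 1) := by
    simp only [hV, halfTerm_succ]
    exact ((summable_halfTerm _ _ _).mul_left _).mul_left _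
  have hV0 : Summable V := (summable_nat_add_iff 1).mp hV1
  have hterm : ∀ n, halfTerm a (1 - a) c n - (c + 1 - a) * (c + a) * halfTerm a (1 - a) (c + 2) n =
      V (n + 1) - V n := by
    intro n
    have hn1 : (n : ℂ) + 1 ≠ 0 := by exact_mod_cast n.succ_ne_zero
    have hf : ((n.factorial : ℕ) : ℂ) ≠ 0 := by exact_mod_cast n.factorial_ne_zero
    have h1 := inv_Gamma_add_nat c n
    have h2 := inv_Gamma_add_nat (c + 1) n
    rw [show c + 1 + n + 1 = c + 2 + n by ring] at h2
    rw [show c + n + 1 = c + 1 + n by ring, h2] at h1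
    simp only [hV]
    unfold halfTerm
    push_cast
    rw [show c + 1 + (n + 1 : ℂ) = c + 2 + n by ring, h1, h2, poch_succ, poch_succ,
      Nat.factorial_succ, pow_succ]
    push_cast
    field_simp
    ring
  have hz : ∑' n, V (n + 1) = ∑' n, V n := by
    rw [hV0.tsum_eq_zero_add]
    simp [hV]
  rw [← sub_eq_zero, ← tsum_mul_left, ← (summable_halfTerm _ _ _).tsum_sub
    ((summable_halfTerm _ _ _).mul_left _), tsum_congr hterm, hV1.tsum_sub hV0, hz, sub_self]

theorem Gamma_add_nat_eq_poch_mul {c : ℂ} (hc : notNonposInt c) (n : ℕ) :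
    Gamma (c + n) = poch c n * Gamma c := by
  induction n with
  | zero => simp [poch_zero]
  | succ n ih =>
    have h : c + n ≠ 0 := fun h => hc n (eq_neg_of_add_eq_zero_left h)
    rw [Nat.cast_succ, ← add_assoc, Gamma_add_one _ h, ih, poch_succ]
    ring

theorem poch_ne_zero {c : ℂ} (hc : notNonposInt c) (n : ℕ) : poch c n ≠ 0 :=
  Finset.prod_ne_zero_iff.mpr fun k _ h => hc k (eq_neg_of_add_eq_zero_left h)

theorem notNonposInt_of_re_pos {c : ℂ} (hc : 0 < c.re) : notNonposInt c := by
  intro n h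
  have h2 : c.re = -(n : ℝ) := by rw [h]; simp
  have h3 : (0 : ℝ) ≤ n := n.cast_nonneg
  linarith

theorem tendsto_poch_div (u : ℂ) :
    Filter.Tendsto (fun n : ℕ => poch u (n + 1) / ((n : ℂ) ^ u * n.factorial)) Filter.atTop
      (nhds (Gamma u)⁻¹) := by
  by_cases hu : notNonposInt u
  · refine ((GammaSeq_tendsto_Gamma u).inv₀ (Gamma_ne_zero hu)).congr fun n => ?_
    rw [GammaSeq, inv_div, poch]
  · obtain ⟨m, hm⟩ : ∃ m : ℕ, u = -(m : ℂ) := by simpa [notNonposInt] using hu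
    rw [(Gamma_eq_zero_iff u).mpr ⟨m, hm⟩, inv_zero]
    refine tendsto_const_nhds.congr' ?_
    filter_upwards [Filter.eventually_ge_atTop m] with n hn
    rw [poch, Finset.prod_eq_zero (Finset.mem_range.mpr (Nat.lt_succ_of_le hn)), zero_div]
    rw [hm, neg_add_cancel]

theorem tendsto_poch_ratio {u v z w : ℂ} (h : u + v = z + w) (hz : notNonposInt z)
    (hw : notNonposInt w) :
    Filter.Tendsto (fun n : ℕ => poch u (n + 1) * poch v (n + 1) /
      (poch z (n + 1) * poch w (n + 1))) Filter.atTop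
      (nhds (Gamma z * Gamma w * (Gamma u)⁻¹ * (Gamma v)⁻¹)) := by
  have hz' := Gamma_ne_zero hz
  have hw' := Gamma_ne_zero hw
  have := ((tendsto_poch_div u).mul (tendsto_poch_div v)).div
    ((tendsto_poch_div z).mul (tendsto_poch_div w))
    (mul_ne_zero (inv_ne_zero hz') (inv_ne_zero hw'))
  rw [show (Gamma u)⁻¹ * (Gamma v)⁻¹ / ((Gamma z)⁻¹ * (Gamma w)⁻¹) =
    Gamma z * Gamma w * (Gamma u)⁻¹ * (Gamma v)⁻¹ by field_simp] at this
  refine this.congr' ?_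
  filter_upwards [Filter.eventually_ge_atTop 1] with n hn
  have hn0 : (n : ℂ) ≠ 0 := by exact_mod_cast (by omega : n ≠ 0)
  have hf : ((n.factorial : ℕ) : ℂ) ≠ 0 := by exact_mod_cast n.factorial_ne_zero
  have hp : (n : ℂ) ^ u * (n : ℂ) ^ v = (n : ℂ) ^ z * (n : ℂ) ^ w := by
    rw [← cpow_add _ _ hn0, ← cpow_add _ _ hn0, h]
  have hz0 : (n : ℂ) ^ z ≠ 0 := by simp [cpow_eq_zero_iff, hn0]
  have hw0 : (n : ℂ) ^ w ≠ 0 := by simp [cpow_eq_zero_iff, hn0]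
  rw [Pi.div_apply, div_mul_div_comm, div_mul_div_comm, div_div_div_eq,
    show (n : ℂ) ^ u * n.factorial * ((n : ℂ) ^ v * n.factorial) =
      (n : ℂ) ^ z * n.factorial * ((n : ℂ) ^ w * n.factorial) by
      linear_combination (n.factorial : ℂ) ^ 2 * hp, mul_comm _ (poch z (n + 1) * poch w (n + 1)),
    mul_div_mul_right]
  exact mul_ne_zero (mul_ne_zero hz0 hf) (mul_ne_zero hw0 hf)

theorem poch_two_mul (c : ℂ) (k : ℕ) :
    poch c (2 * k) = 4 ^ k * poch (c / 2) k * poch ((c + 1) / 2) k := by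
  induction k with
  | zero => simp [poch_zero]
  | succ k ih =>
    rw [show 2 * (k + 1) = 2 * k + 1 + 1 by ring]
    simp only [poch_succ, ih, pow_succ]
    push_cast
    ring

theorem tsum_halfTerm_add_two_mul (a c : ℂ) (k : ℕ) :
    ∑' n, halfTerm a (1 - a) c n = 4 ^ k * poch ((c + a) / 2) k * poch ((c + 1 - a) / 2) k *
      ∑' n, halfTerm a (1 - a) (c + (2 * k : ℕ)) n := by
  induction k with
  | zero => simp [poch_zero]
  | succ k ih =>
    rw [ih, tsum_halfTerm_add_two a (c + (2 * k : ℕ)), poch_succ, poch_succ, pow_succ,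
      show c + ((2 * (k + 1) : ℕ) : ℂ) = c + (2 * k : ℕ) + 2 by push_cast; ring]
    push_cast
    ring

theorem factorial_le_norm_poch {c : ℂ} (hc : 1 ≤ c.re) (n : ℕ) : (n.factorial : ℝ) ≤ ‖poch c n‖ := by
  induction n with
  | zero => simp [poch_zero]
  | succ n ih =>
    rw [poch_succ, norm_mul, Nat.factorial_succ, mul_comm]
    push_cast
    refine mul_le_mul ih ?_ (by positivity) (norm_nonneg _)
    refine le_trans ?_ (re_le_norm _)
    simp
    linarith

theorem tendsto_Gamma_mul_tsum_halfTerm (a b : ℂ) {c : ℂ} (hc : 0 < c.re) :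
    Filter.Tendsto (fun k : ℕ => Gamma (c + k) * ∑' n, halfTerm a b (c + k) n) Filter.atTop
      (nhds 1) := by
  have hk : ∀ k : ℕ, notNonposInt (c + k) := fun k =>
    notNonposInt_of_re_pos (by simp; positivity)
  have hterm : ∀ k n : ℕ, Gamma (c + k) * halfTerm a b (c + k) n =
      poch a n * poch b n / n.factorial * (1 / 2) ^ n * (poch (c + k) n)⁻¹ := by
    intro k n
    have h := Gamma_ne_zero (hk k)
    unfold halfTerm
    rw [Gamma_add_nat_eq_poch_mul (hk k), mul_inv]
    field_simp
  have hone : ∑' n : ℕ, (if n = 0 then (1 : ℂ) else 0) = 1 := tsum_ite_eq 0 _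
  simp_rw [← tsum_mul_left]
  rw [← hone]
  refine tendsto_tsum_of_dominated_convergence (summable_norm_halfTerm a b 1) ?_ ?_
  · intro n
    simp only [hterm]
    rcases n with _ | n
    · simp [poch_zero]
    · have hlow : ∀ k : ℕ, (k : ℝ) ≤ ‖poch (c + k) (n + 1)‖ ∨ k = 0 := by
        intro k
        rcases Nat.eq_zero_or_pos k with h | h
        · exact Or.inr h
        left
        have h1 : (1 : ℝ) ≤ k := by exact_mod_cast h
        rw [poch_succ_left, norm_mul]
        have h2 : (k : ℝ) ≤ ‖c + k‖ := by
          refine le_trans ?_ (re_le_norm _)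
          simp
          linarith
        have h3 : (1 : ℝ) ≤ ‖poch (c + k + 1) n‖ := by
          refine le_trans ?_ (factorial_le_norm_poch (by simp; linarith) n)
          exact_mod_cast n.factorial_pos
        nlinarith
      have hinf : Filter.Tendsto (fun k : ℕ => ‖poch (c + k) (n + 1)‖) Filter.atTop
          Filter.atTop := by
        refine Filter.tendsto_atTop_mono' _ ?_ tendsto_natCast_atTop_atTop
        filter_upwards [Filter.eventually_ge_atTop 1] with k hk1
        exact (hlow k).resolve_right (by omega)
      have h0 : Filter.Tendsto (fun k : ℕ => (poch (c + k) (n + 1))⁻¹) Filter.atTop (nhds 0) := by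
        rw [tendsto_zero_iff_norm_tendsto_zero]
        simp_rw [norm_inv]
        exact hinf.inv_tendsto_atTop
      simpa using h0.const_mul (poch a (n + 1) * poch b (n + 1) / (n + 1).factorial *
        (1 / 2) ^ (n + 1))
  · filter_upwards [Filter.eventually_ge_atTop 1] with k hk1 n
    have h1 : (1 : ℝ) ≤ k := by exact_mod_cast hk1
    have hf := factorial_le_norm_poch (c := c + k) (by simp; linarith) n
    have hf0 : (0 : ℝ) < n.factorial := by exact_mod_cast n.factorial_pos
    have hG : Gamma (1 + n) = n.factorial := by rw [add_comm, Gamma_nat_eq_factorial]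
    rw [hterm, halfTerm, hG, mul_right_comm _ ((n.factorial : ℂ)⁻¹), norm_mul, norm_mul _ ((_)⁻¹),
      norm_inv, norm_inv, norm_natCast]
    gcongr

theorem tsum_halfTerm_one_sub_of_re_pos (a : ℂ) {c : ℂ} (hc : 0 < c.re) :
    ∑' n, halfTerm a (1 - a) c n = 2 ^ (1 - c) * (Real.sqrt Real.pi : ℂ) *
      (Gamma ((c + a) / 2))⁻¹ * (Gamma ((c + 1 - a) / 2))⁻¹ := by
  have hcn := notNonposInt_of_re_pos hc
  have hz : notNonposInt (c / 2) := notNonposInt_of_re_pos (by simp; linarith)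
  have hw : notNonposInt ((c + 1) / 2) := notNonposInt_of_re_pos (by simp; linarith)
  have hG := Gamma_ne_zero hcn
  have h1 : Filter.Tendsto (fun n : ℕ => 2 * (n + 1)) Filter.atTop Filter.atTop :=
    Filter.tendsto_atTop_mono (fun n => by simp only [id]; omega) Filter.tendsto_id
  have h2 := (tendsto_poch_ratio (u := (c + a) / 2) (v := (c + 1 - a) / 2) (z := c / 2)
    (w := (c + 1) / 2) (by ring) hz hw).mul
    ((tendsto_Gamma_mul_tsum_halfTerm a (1 - a) hc).comp h1)
  have h3 : Filter.Tendsto (fun _ : ℕ => Gamma c * ∑' n, halfTerm a (1 - a) c n) Filter.atTop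
      (nhds (Gamma c * ∑' n, halfTerm a (1 - a) c n)) := tendsto_const_nhds
  have h4 := tendsto_nhds_unique_of_eventuallyEq h3 h2 (Filter.Eventually.of_forall fun k => by
    have hz' := poch_ne_zero hz (k + 1)
    have hw' := poch_ne_zero hw (k + 1)
    simp only [Function.comp]
    rw [tsum_halfTerm_add_two_mul a c (k + 1), Gamma_add_nat_eq_poch_mul hcn, poch_two_mul]
    field_simp)
  have hdup := Gamma_mul_Gamma_add_half (c / 2)
  rw [show c / 2 + 1 / 2 = (c + 1) / 2 by ring, mul_div_cancel₀ c two_ne_zero] at hdup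
  rw [hdup] at h4
  apply mul_left_cancel₀ hG
  rw [h4]
  ring

/-- Bailey's summation theorem for `₂F₁(a, 1 - a; c; 1/2)`, in regularised form. -/
theorem tsum_halfTerm_one_sub (a c : ℂ) :
    ∑' n, halfTerm a (1 - a) c n = 2 ^ (1 - c) * (Real.sqrt Real.pi : ℂ) *
      (Gamma ((c + a) / 2))⁻¹ * (Gamma ((c + 1 - a) / 2))⁻¹ := by
  obtain ⟨k, hk⟩ := exists_nat_gt (-c.re)
  have hre : 0 < c.re + 2 * k := by
    have : (0 : ℝ) ≤ k := k.cast_nonneg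
    linarith
  clear hk
  induction k generalizing c with
  | zero => exact tsum_halfTerm_one_sub_of_re_pos a (by simpa using hre)
  | succ k ih =>
    rw [tsum_halfTerm_add_two, ih (c + 2) (by push_cast at hre; simp; linarith),
      one_div_Gamma_eq_self_mul_one_div_Gamma_add_one ((c + a) / 2),
      one_div_Gamma_eq_self_mul_one_div_Gamma_add_one ((c + 1 - a) / 2),
      show (1 : ℂ) - c = 1 - (c + 2) + (2 : ℕ) by push_cast; ring,
      cpow_add _ _ two_ne_zero, cpow_natCast,
      show (c + 2 + a) / 2 = (c + a) / 2 + 1 by ring,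
      show (c + 2 + 1 - a) / 2 = (c + 1 - a) / 2 + 1 by ring]
    ring

/-- The generalisation of Bailey's theorem to `₂F₁(a, 1 - a + i; c; 1/2)`, in regularised form. -/
theorem tsum_halfTerm_one_sub_add (i : ℕ) (a c : ℂ) (hca : notNonposInt (c - a))
    (hai : notNonposInt (a - i)) :
    ∑' n, halfTerm a (1 - a + i) c n =
      2 ^ ((i : ℂ) - a) * Gamma (a - i) / (Gamma a * Gamma (c - a)) *
      ∑ r ∈ Finset.range (i + 1), (-1 : ℂ) ^ r * (i.choose r : ℂ) *
        Gamma ((c - a + r) / 2) / Gamma ((c + a + r) / 2 - i) := by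
  induction i generalizing a c with
  | zero =>
    have ha : Gamma a ≠ 0 := Gamma_ne_zero (by simpa [notNonposInt] using hai)
    have hs : notNonposInt ((c - a) / 2) := fun n h =>
      hca (2 * n) (by push_cast; linear_combination 2 * h)
    have hs' : notNonposInt ((c + 1 - a) / 2) := fun n h =>
      hca (2 * n + 1) (by push_cast; linear_combination 2 * h)
    have hdup := Gamma_mul_Gamma_add_half ((c - a) / 2)
    rw [show (c - a) / 2 + 1 / 2 = (c + 1 - a) / 2 by ring, mul_div_cancel₀ _ two_ne_zero] at hdup
    have h1 := Gamma_ne_zero hs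
    have h2 := Gamma_ne_zero hs'
    have h3 := Gamma_ne_zero hca
    have hpow : (2 : ℂ) ^ (1 - c) = 2 ^ (1 - (c - a)) * 2 ^ (-a) := by
      rw [← cpow_add _ _ two_ne_zero]
      congr 1
      ring
    simp only [Nat.cast_zero, add_zero, sub_zero, zero_add, Finset.range_one,
      Finset.sum_singleton, pow_zero, Nat.choose_self, Nat.cast_one, one_mul, zero_sub]
    rw [tsum_halfTerm_one_sub, hpow, div_eq_mul_inv _ (Gamma ((c + a) / 2))]
    field_simp
    linear_combination (-(Gamma ((c + a) / 2))⁻¹) * hdup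
  | succ i ih =>
    obtain ⟨a, rfl⟩ : ∃ a', a = a' + 1 := ⟨a - 1, by ring⟩
    have hai' : notNonposInt (a - i) := fun n h =>
      hai n (by push_cast; linear_combination h)
    have ha0 : a ≠ 0 := fun h => hai' i (by rw [h]; ring)
    have hca' : notNonposInt (c - a) := fun n h =>
      hca (n + 1) (by push_cast; linear_combination h)
    have hca1 : notNonposInt (c - 1 - a) := fun n h => hca n (by linear_combination h)
    have hca0 : c - a - 1 ≠ 0 := fun h => hca 0 (by push_cast; linear_combination h)
    have hrec := tsum_halfTerm_contiguous a (1 - a + i) c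
    rw [ih a (c - 1) hca1 hai', ih a c hca' hai'] at hrec
    have hG1 : Gamma (c - a) = (c - a - 1) * Gamma (c - a - 1) := by
      rw [← Gamma_add_one _ hca0, sub_add_cancel]
    rw [show 1 - (a + 1) + ((i + 1 : ℕ) : ℂ) = 1 - a + i by push_cast; ring,
      show ((i + 1 : ℕ) : ℂ) - (a + 1) = i - a by push_cast; ring,
      show a + 1 - ((i + 1 : ℕ) : ℂ) = a - i by push_cast; ring,
      show c - (a + 1) = c - a - 1 by ring, Gamma_add_one _ ha0]
    rw [show c - 1 - a = c - a - 1 by ring, hG1] at hrec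
    have hsplit : ∑ r ∈ Finset.range (i + 1 + 1), (-1 : ℂ) ^ r * ((i + 1).choose r : ℂ) *
          Gamma ((c - a - 1 + r) / 2) / Gamma ((c + (a + 1) + r) / 2 - (i + 1 : ℕ)) =
        ∑ r ∈ Finset.range (i + 1), (-1 : ℂ) ^ r * (i.choose r : ℂ) *
          Gamma ((c - a - 1 + r) / 2) / Gamma ((c - 1 + a + r) / 2 - i) -
        ∑ r ∈ Finset.range (i + 1), (-1 : ℂ) ^ r * (i.choose r : ℂ) *
          Gamma ((c - a + r) / 2) / Gamma ((c + a + r) / 2 - i) := by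
      have h := Finset.sum_antidiagonal_choose_succ_mul (R := ℂ) (fun r _ => (-1 : ℂ) ^ r *
        (Gamma ((c - a - 1 + r) / 2) / Gamma ((c + (a + 1) + r) / 2 - (i + 1 : ℕ)))) i
      simp only [Finset.Nat.sum_antidiagonal_eq_sum_range_succ_mk, Nat.succ_eq_add_one] at h
      refine Eq.trans ?_ (sub_eq_add_neg _ _).symm
      rw [← Finset.sum_neg_distrib]
      convert h using 2
      · ring
      · refine Finset.sum_congr rfl fun r _ => ?_
        rw [show (c + (a + 1) + r) / 2 - ((i + 1 : ℕ) : ℂ) = (c - 1 + a + r) / 2 - i by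
          push_cast; ring]
        ring
      · refine Finset.sum_congr rfl fun r hr => ?_
        rw [Nat.choose_symm (Nat.lt_succ_iff.mp (Finset.mem_range.mp hr)),
          show (c + (a + 1) + ((r + 1 : ℕ) : ℂ)) / 2 - ((i + 1 : ℕ) : ℂ) = (c + a + r) / 2 - i by
          push_cast; ring, show (c - a - 1 + ((r + 1 : ℕ) : ℂ)) / 2 = (c - a + r) / 2 by
          push_cast; ring]
        ring
    rw [hsplit]
    apply mul_left_cancel₀ ha0
    rw [hrec]
    field_simp

theorem poch_add (a : ℂ) (m n : ℕ) : poch a (n + m) = poch a n * poch (a + n) m := by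
  simp [poch, Finset.prod_range_add, add_assoc]

theorem sum_antidiagonal_wellPoised (α β b : ℂ) (N : ℕ) :
    ∑ ij ∈ Finset.HasAntidiagonal.antidiagonal N, (N.choose ij.1 : ℂ) *
      (poch (β - b) ij.2 * poch b ij.1 * poch ((α - β) / 2) ij.1 * (α + 2 * ij.1) *
        poch (1 + (α + β) / 2 + ij.1) ij.2) =
    poch β N * ((α + N) * poch (1 + (α + β) / 2 - b) N -
      N * ((α + β) / 2 + N) * poch (1 + (α + β) / 2 - b) (N - 1)) := by
  have h1 := sum_saalschutz b ((α - β) / 2) ((α + β) / 2) N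
  have h2 := sum_saalschutz b ((α - β) / 2 + 1) (1 + (α + β) / 2) N
  rw [show (α + β) / 2 - b - (α - β) / 2 = β - b by ring,
    show (α + β) / 2 - (α - β) / 2 = β by ring] at h1
  rw [show 1 + (α + β) / 2 - b - ((α - β) / 2 + 1) = β - b by ring,
    show 1 + (α + β) / 2 - ((α - β) / 2 + 1) = β by ring] at h2
  have hsum : ∀ ij ∈ Finset.HasAntidiagonal.antidiagonal N, (N.choose ij.1 : ℂ) *
      (poch (β - b) ij.2 * poch b ij.1 * poch ((α - β) / 2) ij.1 * (α + 2 * ij.1) *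
        poch (1 + (α + β) / 2 + ij.1) ij.2) =
      ((α + β) / 2 + N) * ((N.choose ij.1 : ℂ) * (poch (β - b) ij.2 * poch b ij.1 *
        poch ((α - β) / 2) ij.1 * poch ((α + β) / 2 + ij.1) ij.2)) +
      (α - β) / 2 * ((N.choose ij.1 : ℂ) * (poch (β - b) ij.2 * poch b ij.1 *
        poch ((α - β) / 2 + 1) ij.1 * poch (1 + (α + β) / 2 + ij.1) ij.2)) := by
    rintro ⟨n, k⟩ h
    obtain rfl : n + k = N := by simpa using h
    have e1 : (α - β) / 2 * poch ((α - β) / 2 + 1) n =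
        poch ((α - β) / 2) n * ((α - β) / 2 + n) := by rw [← poch_succ_left, poch_succ]
    have e2 : ((α + β) / 2 + n) * poch ((α + β) / 2 + n + 1) k =
        poch ((α + β) / 2 + n) k * ((α + β) / 2 + n + k) := by rw [← poch_succ_left, poch_succ]
    simp only
    rw [show 1 + (α + β) / 2 + (n : ℂ) = (α + β) / 2 + n + 1 by ring]
    push_cast
    linear_combination
      (-((n + k).choose n : ℂ) * poch (β - b) k * poch b n * poch ((α + β) / 2 + n + 1) k) * e1 +
      (((n + k).choose n : ℂ) * poch (β - b) k * poch b n * poch ((α - β) / 2) n) * e2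
  rw [Finset.sum_congr rfl hsum, Finset.sum_add_distrib, ← Finset.mul_sum, ← Finset.mul_sum, h1, h2]
  cases N with
  | zero => simp [poch_zero]; ring
  | succ N =>
    rw [Nat.add_sub_cancel, show (α + β) / 2 - b = 1 + (α + β) / 2 - b - 1 by ring,
      poch_succ_left (1 + (α + β) / 2 - b - 1), sub_add_cancel, poch_succ (1 + (α + β) / 2 - b)]
    push_cast
    ring

theorem sum_antidiagonal_kdfTerm (α β b : ℂ) (hα : ∀ n, poch (α / 2) n ≠ 0)
    (hβ : ∀ n, poch β n ≠ 0) (hc : ∀ n, poch (1 + (α + β) / 2) n ≠ 0) (N : ℕ) :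
    ∑ p ∈ Finset.HasAntidiagonal.antidiagonal N,
      kdfTerm α (β - b) b (1 + α / 2) ((α - β) / 2) β (α / 2) (1 + (α + β) / 2) (1/2) (1/2) p =
    poch α N / (α * poch (1 + (α + β) / 2) N * N.factorial) * (1 / 2) ^ N *
      ((α + N) * poch (1 + (α + β) / 2 - b) N -
        N * ((α + β) / 2 + N) * poch (1 + (α + β) / 2 - b) (N - 1)) := by
  have hα0 : α ≠ 0 := fun h => hα 1 (by simp [poch, h])
  have hβN := hβ N
  have hcN := hc N
  have hterm : ∀ ij ∈ Finset.HasAntidiagonal.antidiagonal N,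
      kdfTerm α (β - b) b (1 + α / 2) ((α - β) / 2) β (α / 2) (1 + (α + β) / 2) (1/2) (1/2)
        ij.swap =
      poch α N / (α * poch (1 + (α + β) / 2) N * N.factorial) * (1 / 2) ^ N * (poch β N)⁻¹ *
        ((N.choose ij.1 : ℂ) *
      (poch (β - b) ij.2 * poch b ij.1 * poch ((α - β) / 2) ij.1 * (α + 2 * ij.1) *
        poch (1 + (α + β) / 2 + ij.1) ij.2)) := by
    rintro ⟨n, k⟩ h
    obtain rfl : n + k = N := by simpa using h
    have e1 : poch (1 + α / 2) n = poch (α / 2) n * (α + 2 * n) / α := by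
      have e : α / 2 * poch (α / 2 + 1) n = poch (α / 2) n * (α / 2 + n) := by
        rw [← poch_succ_left, poch_succ]
      rw [eq_div_iff hα0, add_comm 1]
      linear_combination 2 * e
    have e2 : ((n + k).factorial : ℂ) = (n + k).choose n * n.factorial * k.factorial := by
      rw [Nat.choose_symm_add]
      exact_mod_cast (Nat.add_choose_mul_factorial_mul_factorial n k).symm
    have hn : ((n.factorial : ℕ) : ℂ) ≠ 0 := by exact_mod_cast n.factorial_ne_zero
    have hk : ((k.factorial : ℕ) : ℂ) ≠ 0 := by exact_mod_cast k.factorial_ne_zero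
    have hch : ((n + k).choose n : ℂ) ≠ 0 := by
      exact_mod_cast (Nat.choose_pos (Nat.le_add_right n k)).ne'
    have hαn := hα n
    have hcn := hc n
    rw [poch_add (1 + (α + β) / 2)] at hcN
    have hck := right_ne_zero_of_mul hcN
    simp only [kdfTerm, Prod.swap_prod_mk]
    rw [add_comm k n, e1, e2, poch_add (1 + (α + β) / 2), pow_add]
    generalize 1 + (α + β) / 2 = c at *
    field_simp
  rw [← Finset.Nat.sum_antidiagonal_swap, Finset.sum_congr rfl hterm, ← Finset.mul_sum,
    sum_antidiagonal_wellPoised]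
  field_simp

theorem tsum_kdfTerm (α β b : ℂ) (hα : ∀ n, poch (α / 2) n ≠ 0)
    (hβ : ∀ n, poch β n ≠ 0) (hc : notNonposInt (1 + (α + β) / 2))
    (hsum : Summable (kdfTerm α (β - b) b (1 + α / 2) ((α - β) / 2) β (α / 2)
      (1 + (α + β) / 2) (1/2) (1/2))) :
    ∑' p, kdfTerm α (β - b) b (1 + α / 2) ((α - β) / 2) β (α / 2) (1 + (α + β) / 2)
      (1/2) (1/2) p =
    Gamma (1 + (α + β) / 2) / 2 *
      ∑' n, halfTerm (α + 1) (1 + (α + β) / 2 - b) (1 + (α + β) / 2) n := by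
  have hα0 : α ≠ 0 := fun h => hα 1 (by simp [poch, h])
  have hG := Gamma_ne_zero hc
  set h : ℕ → ℂ := halfTerm (α + 1) (1 + (α + β) / 2 - b) (1 + (α + β) / 2) with hh
  have hs : Summable h := summable_halfTerm _ _ _
  have hs1 : Summable fun n => h (n + 1) := (summable_nat_add_iff 1).mpr hs
  set S : ℕ → ℂ := fun N => ∑ p ∈ Finset.HasAntidiagonal.antidiagonal N,
    kdfTerm α (β - b) b (1 + α / 2) ((α - β) / 2) β (α / 2) (1 + (α + β) / 2) (1/2) (1/2) p with hS
  have hsig := Finset.HasAntidiagonal.sigmaAntidiagonalEquivProd.summable_iff.mpr hsum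
  have htot : HasSum S (∑' p, kdfTerm α (β - b) b (1 + α / 2) ((α - β) / 2) β (α / 2)
      (1 + (α + β) / 2) (1/2) (1/2) p) := by
    rw [← Finset.HasAntidiagonal.sigmaAntidiagonalEquivProd.tsum_eq]
    refine hsig.hasSum.sigma fun N => ?_
    rw [hS]
    exact Finset.hasSum _ _
  have hS0 : S 0 = Gamma (1 + (α + β) / 2) * h 0 := by
    rw [hS, hh, halfTerm_zero, mul_inv_cancel₀ hG]
    simp [kdfTerm, poch_zero]
  have hS1 : ∀ n, S (n + 1) = Gamma (1 + (α + β) / 2) * (h (n + 1) - 1 / 2 * h n) := by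
    intro n
    have hcn := poch_ne_zero hc n
    have hcn1 := poch_ne_zero hc (n + 1)
    have hn : ((n.factorial : ℕ) : ℂ) ≠ 0 := by exact_mod_cast n.factorial_ne_zero
    have hn1 : (n : ℂ) + 1 ≠ 0 := by exact_mod_cast n.succ_ne_zero
    have hcc : 1 + (α + β) / 2 + (n : ℂ) ≠ 0 := fun h => hc n (eq_neg_of_add_eq_zero_left h)
    simp only [hS, hh]
    rw [sum_antidiagonal_kdfTerm α β b hα hβ (poch_ne_zero hc), Nat.add_sub_cancel]
    unfold halfTerm
    rw [Gamma_add_nat_eq_poch_mul hc, Gamma_add_nat_eq_poch_mul hc, poch_succ_left α,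
      poch_succ (α + 1), poch_succ (1 + (α + β) / 2), poch_succ (1 + (α + β) / 2 - b),
      Nat.factorial_succ, pow_succ]
    have hγ : (α + β) / 2 + ((n + 1 : ℕ) : ℂ) = 1 + (α + β) / 2 + n := by push_cast; ring
    rw [hγ]
    generalize 1 + (α + β) / 2 = c at *
    push_cast
    field_simp
    ring
  rw [← htot.tsum_eq, htot.summable.tsum_eq_zero_add, hS0, tsum_congr hS1, tsum_mul_left,
    hs1.tsum_sub (hs.mul_left _), tsum_mul_left, hs.tsum_eq_zero_add]
  ring

theorem stmt_9 (i : ℕ) (α β : ℂ)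
    (hβ : ∀ m n : ℕ, poch β (m + n) ≠ 0)
    (hd1 : ∀ n : ℕ, poch (α / 2) n ≠ 0)
    (hd2 : ∀ n : ℕ, poch (1 + (α + β) / 2) n ≠ 0)
    (hΓ1 : notNonposInt (α - (i : ℂ) + 1))
    (hΓ2 : notNonposInt (1 + (α + β) / 2))
    (hΓ3 : notNonposInt (α + 1))
    (hΓ4 : notNonposInt ((β - α) / 2))
    (hΓs : ∀ r : ℕ, r ≤ i →
      notNonposInt ((β - α) / 4 + (r : ℂ) / 2) ∧ notNonposInt ((β + 3 * α) / 4 + 1 - (i : ℂ) + (r : ℂ) / 2))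
    (hsum : Summable fun p : ℕ × ℕ => ‖kdfTerm α (β / 2 - 3 * α / 2 - 1 + (i : ℂ)) (β / 2 + 3 * α / 2 + 1 - (i : ℂ)) (1 + α / 2) ((α - β) / 2) β (α / 2) (1 + (α + β) / 2) (1/2) (1/2) p‖) :
    (∑' p : ℕ × ℕ, kdfTerm α (β / 2 - 3 * α / 2 - 1 + (i : ℂ)) (β / 2 + 3 * α / 2 + 1 - (i : ℂ)) (1 + α / 2) ((α - β) / 2) β (α / 2) (1 + (α + β) / 2) (1/2) (1/2) p) =
      (2 : ℂ) ^ ((i : ℂ) - α - 2) * Gamma (α - (i : ℂ) + 1) * Gamma (1 + (α + β) / 2) /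
        (Gamma (α + 1) * Gamma ((β - α) / 2)) *
      ∑ r ∈ Finset.range (i + 1), (-1 : ℂ) ^ r * (i.choose r : ℂ) *
        Gamma ((β - α) / 4 + (r : ℂ) / 2) /
        Gamma ((β + 3 * α) / 4 + 1 - (i : ℂ) + (r : ℂ) / 2) := by
  have hε : β / 2 - 3 * α / 2 - 1 + (i : ℂ) = β - (β / 2 + 3 * α / 2 + 1 - i) := by ring
  have hb : 1 + (α + β) / 2 - (β / 2 + 3 * α / 2 + 1 - i) = 1 - (α + 1) + i := by ring
  have hca : 1 + (α + β) / 2 - (α + 1) = (β - α) / 2 := by ring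
  rw [hε] at hsum ⊢
  rw [tsum_kdfTerm α β _ hd1 (fun n => by simpa using hβ 0 n) hΓ2 hsum.of_norm, hb,
    tsum_halfTerm_one_sub_add i (α + 1) _ (by rwa [hca])
      (by rwa [show α + 1 - (i : ℂ) = α - i + 1 by ring]), hca,
    show (i : ℂ) - α - 2 = (i - (α + 1)) - 1 by ring, cpow_sub _ 1 two_ne_zero, cpow_one,
    show α + 1 - (i : ℂ) = α - i + 1 by ring]
  rw [← mul_assoc]
  congr 1
  · ring
  · refine Finset.sum_congr rfl fun r _ => ?_
    rw [show ((β - α) / 2 + r) / 2 = (β - α) / 4 + (r : ℂ) / 2 by ring,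
      show (1 + (α + β) / 2 + (α + 1) + r) / 2 - (i : ℂ) =
        (β + 3 * α) / 4 + 1 - i + (r : ℂ) / 2 by ring]
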